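/- Let μ₁, …, μ_T be probability measures on a measurable space 𝒳, let κ₁, …, κ_T ∈ (0,1) with κ₁ + ⋯ + κ_T = 1, and set μ₀ = Σ_{t=1}^T κ_t μ_t, so each μ_t is absolutely continuous with respect to μ₀ with Radon–Nikodym derivative ρ_t = dμ_t/dμ₀ satisfying Σ_t κ_t ρ_t = 1 μ₀-almost everywhere. Let 0 < c ≤ C < ∞, let v₀, v₁ : 𝒳 → [c, C] and ψ : 𝒳 → ℝ^p be measurable with ‖ψ(x)‖ ≤ C, and write φ(e, x) = e(1−e)/(v₀(x)e + v₁(x)(1−e)) for e ∈ [0,1]. Let e₁, …, e_T : 𝒳 → [0,1] be measurable and let e₀ : 𝒳 → [0,1] be any measurable function equal μ₀-almost everywhere to Σ_{t=1}^T κ_t ρ_t e_t. Then Σ_{t=1}^T κ_t ∫ φ(e_t(x), x) ψ(x)ψ(x)ᵀ dμ_t(x) ⪯ ∫ φ(e₀(x), x) ψ(x)ψ(x)ᵀ dμ₀(x) in the Loewner order; consequently, if the left-hand side is positive definite, then (∫ φ(e₀)ψψᵀ dμ₀)⁻¹ ⪯ (Σ_t κ_t ∫ φ(e_t)ψψᵀ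 dμ_t)⁻¹. -/

import Mathlib

open MeasureTheory

theorem convexCombination_pos {a b u : ℝ} (ha : 0 < a) (hb : 0 < b)
    (hu : u ∈ Set.Icc (0 : ℝ) 1) : 0 < a * u + b * (1 - u) := by
  rcases hu.1.eq_or_lt with rfl | h
  · simpa using hb
  · exact add_pos_of_pos_of_nonneg (mul_pos ha h) (mul_nonneg hb.le (sub_nonneg.2 hu.2))

/-- Affine majorants of the parallel sum `u (1 - u) / (a u + b (1 - u))`, indexed by `l`. -/
theorem propensity_info_le_affine {a b u : ℝ} (ha : 0 < a) (hb : 0 < b)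
    (hu : u ∈ Set.Icc (0 : ℝ) 1) (l : ℝ) :
    u * (1 - u) / (a * u + b * (1 - u)) ≤ l ^ 2 * u / b + (1 - l) ^ 2 * (1 - u) / a := by
  obtain ⟨h0, h1⟩ := hu
  have hd := convexCombination_pos ha hb ⟨h0, h1⟩
  have key : l ^ 2 * u / b + (1 - l) ^ 2 * (1 - u) / a - u * (1 - u) / (a * u + b * (1 - u))
      = (l * (a * u + b * (1 - u)) - b * (1 - u)) ^ 2 / (a * b * (a * u + b * (1 - u))) := by
    generalize hD : a * u + b * (1 - u) = D at hd ⊢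
    field_simp
    rw [← hD]
    ring
  rw [← sub_nonneg, key]
  positivity

/-- Jensen's inequality for the information function `u (1 - u) / (a u + b (1 - u))`. -/
theorem sum_propensity_info_le {ι : Type*} (s : Finset ι) {a b : ℝ} (ha : 0 < a) (hb : 0 < b)
    (w e : ι → ℝ) (hw : ∀ t ∈ s, 0 ≤ w t) (hw1 : ∑ t ∈ s, w t = 1)
    (he : ∀ t ∈ s, e t ∈ Set.Icc (0 : ℝ) 1) {u : ℝ} (hu : u = ∑ t ∈ s, w t * e t) :
    ∑ t ∈ s, w t * (e t * (1 - e t) / (a * e t + b * (1 - e t)))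
      ≤ u * (1 - u) / (a * u + b * (1 - u)) := by
  have hu0 : 0 ≤ u := hu ▸ Finset.sum_nonneg fun t ht => mul_nonneg (hw t ht) (he t ht).1
  have hu1 : u ≤ 1 := by
    rw [hu, ← hw1]
    exact Finset.sum_le_sum fun t ht => mul_le_of_le_one_right (hw t ht) (he t ht).2
  have hd := convexCombination_pos ha hb ⟨hu0, hu1⟩
  set l := b * (1 - u) / (a * u + b * (1 - u)) with hl
  calc _ ≤ ∑ t ∈ s, w t * (l ^ 2 * e t / b + (1 - l) ^ 2 * (1 - e t) / a) :=
        Finset.sum_le_sum fun t ht =>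
          mul_le_mul_of_nonneg_left (propensity_info_le_affine ha hb (he t ht) l) (hw t ht)
    _ = l ^ 2 / b * (∑ t ∈ s, w t * e t)
          + (1 - l) ^ 2 / a * (∑ t ∈ s, w t - ∑ t ∈ s, w t * e t) := by
        rw [← Finset.sum_sub_distrib, Finset.mul_sum, Finset.mul_sum, ← Finset.sum_add_distrib]
        exact Finset.sum_congr rfl fun t _ => by ring
    _ = l ^ 2 / b * u + (1 - l) ^ 2 / a * (1 - u) := by rw [hw1, ← hu]
    _ = _ := by
        have hl' : 1 - l = a * u / (a * u + b * (1 - u)) := by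
          rw [hl, eq_div_iff hd.ne', sub_mul, div_mul_cancel₀ _ hd.ne']
          ring
        rw [hl', hl]
        generalize hD : a * u + b * (1 - u) = D at hd ⊢
        field_simp
        rw [← hD]
        ring

theorem abs_propensity_info_le {a b c u : ℝ} (hc : 0 < c) (ha : c ≤ a) (hb : c ≤ b)
    (hu : u ∈ Set.Icc (0 : ℝ) 1) :
    |u * (1 - u) / (a * u + b * (1 - u))| ≤ 1 / c := by
  obtain ⟨h0, h1⟩ := hu
  have hd : c ≤ a * u + b * (1 - u) := by
    nlinarith [mul_le_mul_of_nonneg_right ha h0,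
      mul_le_mul_of_nonneg_right hb (sub_nonneg.2 h1)]
  have hn : 0 ≤ u * (1 - u) := mul_nonneg h0 (sub_nonneg.2 h1)
  rw [abs_of_nonneg (div_nonneg hn (hc.le.trans hd))]
  exact div_le_div₀ zero_le_one (by nlinarith) hc hd

theorem integrable_mul_coord_mul_coord {𝒳 : Type*} [MeasurableSpace 𝒳] {ν : Measure 𝒳} {p : ℕ}
    {ψ : 𝒳 → EuclideanSpace ℝ (Fin p)} (hψm : Measurable ψ) {C : ℝ} (hψ : ∀ x, ‖ψ x‖ ≤ C)
    {h : 𝒳 → ℝ} (hh : Integrable h ν) (i j : Fin p) :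
    Integrable (fun x => h x * (ψ x i * ψ x j)) ν := by
  refine hh.mul_bdd (c := C * C) (by fun_prop) (.of_forall fun x => ?_)
  have hx (k : Fin p) : ‖ψ x k‖ ≤ C := (PiLp.norm_apply_le (ψ x) k).trans (hψ x)
  rw [norm_mul]
  exact mul_le_mul (hx i) (hx j) (norm_nonneg _) ((norm_nonneg _).trans (hx i))

/-- A second-moment matrix with an almost everywhere nonnegative weight is positive
semidefinite. -/
theorem posSemidef_integral_weighted_outer {𝒳 : Type*} [MeasurableSpace 𝒳] {ν : Measure 𝒳}
    {p : ℕ} {ψ : 𝒳 → EuclideanSpace ℝ (Fin p)} (hψm : Measurable ψ) {C : ℝ}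
    (hψ : ∀ x, ‖ψ x‖ ≤ C) {h : 𝒳 → ℝ} (hh : Integrable h ν) (h0 : ∀ᵐ x ∂ν, 0 ≤ h x) :
    (Matrix.of fun i j => ∫ x, h x * (ψ x i * ψ x j) ∂ν).PosSemidef := by
  refine .of_dotProduct_mulVec_nonneg ?_ fun y => ?_
  · ext i j
    simp [mul_comm (ψ _ i)]
  · have hint := integrable_mul_coord_mul_coord hψm hψ hh
    have heq : star y ⬝ᵥ ((Matrix.of fun i j => ∫ x, h x * (ψ x i * ψ x j) ∂ν).mulVec y)
        = ∫ x, h x * (∑ i, y i * ψ x i) ^ 2 ∂ν := by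
      simp only [dotProduct, Matrix.mulVec, Matrix.of_apply, star_trivial, Finset.mul_sum]
      simp_rw [← integral_mul_const, ← integral_const_mul]
      rw [← Finset.sum_congr rfl fun i _ => integral_finsetSum _ fun j _ =>
        ((hint i j).mul_const (y j)).const_mul (y i)]
      rw [← integral_finsetSum _ fun i _ => integrable_finsetSum _ fun j _ =>
        ((hint i j).mul_const (y j)).const_mul (y i)]
      refine integral_congr_ae (.of_forall fun x => ?_)
      simp only [sq, Finset.sum_mul_sum]
      simp only [Finset.mul_sum]
      exact Finset.sum_congr rfl fun i _ => Finset.sum_congr rfl fun j _ => by ring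
    rw [heq]
    exact integral_nonneg_of_ae (h0.mono fun x hx => mul_nonneg hx (sq_nonneg _))

/-- Matrix inversion is antitone for the Loewner order on positive definite matrices. -/
theorem Matrix.PosDef.posSemidef_inv_sub_inv {n : Type*} [Fintype n] [DecidableEq n]
    {A B : Matrix n n ℝ} (hA : A.PosDef) (hAB : (B - A).PosSemidef) :
    (A⁻¹ - B⁻¹).PosSemidef := by
  have hB : B.PosDef := by simpa using hA.add_posSemidef hAB
  let := hB.isUnit.invertible
  let := hA.inv.isUnit.invertible
  have hA' : A⁻¹⁻¹ = A :=
    Matrix.nonsing_inv_nonsing_inv A ((Matrix.isUnit_iff_isUnit_det A).1 hA.isUnit)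
  have h₁ := Matrix.PosDef.fromBlocks₁₁ (1 : Matrix n n ℝ) A⁻¹ hB
  have h₂ := Matrix.PosDef.fromBlocks₂₂ B (1 : Matrix n n ℝ) hA.inv
  simp only [Matrix.conjTranspose_one, Matrix.one_mul, Matrix.mul_one, hA'] at h₁ h₂
  exact h₁.1 (h₂.2 hAB)

/-- Pooling dominates linear aggregation for the partially linear
model with non-stationary batches (covariate shift).  `μ t` is the batch-`t`
covariate distribution, `μ₀ = ∑ κ_t • μ t` the pooled distribution with
Radon–Nikodym derivatives `ρ t = dμ_t/dμ₀`, and `e₀` the mixture propensity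
`∑ κ_t ρ_t e_t` (μ₀-a.e.).  Then
`∑ κ_t ∫ φ(e_t)ψψᵀ dμ_t ⪯ ∫ φ(e₀)ψψᵀ dμ₀`, and if the left side is positive
definite, the reversed inequality holds for the inverses. -/
theorem pooled_info_dominates_aggregated_info_nonstationary
    {𝒳 : Type*} [MeasurableSpace 𝒳]
    (T : ℕ) (hT : 1 ≤ T)
    (μ : Fin T → Measure 𝒳) [∀ t, IsProbabilityMeasure (μ t)]
    (κ : Fin T → ℝ) (hκ : ∀ t, κ t ∈ Set.Ioo (0 : ℝ) 1) (hκsum : ∑ t, κ t = 1)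
    (μ0 : Measure 𝒳) (hμ0 : μ0 = ∑ t, ENNReal.ofReal (κ t) • μ t)
    (ρ : Fin T → 𝒳 → ℝ) (hρm : ∀ t, Measurable (ρ t)) (hρ0 : ∀ t x, 0 ≤ ρ t x)
    (hρ : ∀ t, μ t = μ0.withDensity fun x => ENNReal.ofReal (ρ t x))
    (hρsum : ∀ᵐ x ∂μ0, ∑ t, κ t * ρ t x = 1)
    (p : ℕ) (c C : ℝ) (hc : 0 < c) (hcC : c ≤ C)
    (v0 v1 : 𝒳 → ℝ) (hv0m : Measurable v0) (hv1m : Measurable v1)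
    (hv0 : ∀ x, v0 x ∈ Set.Icc c C) (hv1 : ∀ x, v1 x ∈ Set.Icc c C)
    (ψ : 𝒳 → EuclideanSpace ℝ (Fin p)) (hψm : Measurable ψ) (hψ : ∀ x, ‖ψ x‖ ≤ C)
    (φ : ℝ → 𝒳 → ℝ)
    (hφ : ∀ u x, φ u x = u * (1 - u) / (v0 x * u + v1 x * (1 - u)))
    (e : Fin T → 𝒳 → ℝ) (hem : ∀ t, Measurable (e t))
    (he : ∀ t x, e t x ∈ Set.Icc (0 : ℝ) 1)
    (e0 : 𝒳 → ℝ) (he0m : Measurable e0) (he0mem : ∀ x, e0 x ∈ Set.Icc (0 : ℝ) 1)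
    (he0 : ∀ᵐ x ∂μ0, e0 x = ∑ t, κ t * ρ t x * e t x)
    (A B : Matrix (Fin p) (Fin p) ℝ)
    (hA : A = ∑ t, κ t •
      (Matrix.of fun i j => ∫ x, φ (e t x) x * (ψ x i * ψ x j) ∂(μ t)))
    (hB : B = Matrix.of fun i j => ∫ x, φ (e0 x) x * (ψ x i * ψ x j) ∂μ0) :
    (B - A).PosSemidef ∧ (A.PosDef → (A⁻¹ - B⁻¹).PosSemidef) := by
  have hi0 : IsFiniteMeasure μ0 := by
    refine ⟨?_⟩
    simp [hμ0, Measure.finsetSum_apply, ENNReal.sum_lt_top]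
  have hφm {f : 𝒳 → ℝ} (hf : Measurable f) : Measurable fun x => φ (f x) x := by
    simp only [hφ]
    fun_prop
  have hφi {f : 𝒳 → ℝ} (hf : Measurable f) (hf1 : ∀ x, f x ∈ Set.Icc (0 : ℝ) 1)
      (ν : Measure 𝒳) [IsFiniteMeasure ν] : Integrable (fun x => φ (f x) x) ν :=
    .of_bound (hφm hf).aestronglyMeasurable (1 / c) (.of_forall fun x => by
      rw [Real.norm_eq_abs, hφ]
      exact abs_propensity_info_le hc (hv0 x).1 (hv1 x).1 (hf1 x))
  have hρm' (t : Fin T) : Measurable fun x => ENNReal.ofReal (ρ t x) := (hρm t).ennreal_ofReal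
  have hρt (t : Fin T) : ∀ᵐ x ∂μ0, ENNReal.ofReal (ρ t x) < ⊤ :=
    .of_forall fun x => ENNReal.ofReal_lt_top
  have hti (t : Fin T) : Integrable (fun x => κ t * ρ t x * φ (e t x) x) μ0 := by
    have h := hφi (hem t) (he t) (μ t)
    rw [hρ t, integrable_withDensity_iff (hρm' t) (hρt t)] at h
    simp only [ENNReal.toReal_ofReal (hρ0 t _)] at h
    convert h.const_mul (κ t) using 2
    ring
  have hBA : B - A = Matrix.of fun i j => ∫ x, (φ (e0 x) x - ∑ t, κ t * ρ t x * φ (e t x) x)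
      * (ψ x i * ψ x j) ∂μ0 := by
    ext i j
    have hchange (t : Fin T) : κ t * ∫ x, φ (e t x) x * (ψ x i * ψ x j) ∂(μ t)
        = ∫ x, κ t * ρ t x * φ (e t x) x * (ψ x i * ψ x j) ∂μ0 := by
      rw [hρ t, integral_withDensity_eq_integral_toReal_smul (hρm' t) (hρt t),
        ← integral_const_mul]
      simp only [ENNReal.toReal_ofReal (hρ0 t _), smul_eq_mul, mul_assoc]
    simp only [hA, hB, Matrix.sub_apply, Matrix.sum_apply, Matrix.smul_apply, Matrix.of_apply,
      smul_eq_mul, hchange, sub_mul, Finset.sum_mul]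
    have hint := fun t => integrable_mul_coord_mul_coord hψm hψ (hti t) i j
    rw [integral_sub (integrable_mul_coord_mul_coord hψm hψ (hφi he0m he0mem μ0) i j)
      (integrable_finsetSum _ fun t _ => hint t), integral_finsetSum _ fun t _ => hint t]
  have hpsd : (B - A).PosSemidef := by
    rw [hBA]
    refine posSemidef_integral_weighted_outer hψm hψ
      ((hφi he0m he0mem μ0).sub (integrable_finsetSum _ fun t _ => hti t)) ?_
    filter_upwards [hρsum, he0] with x hx1 hx2
    rw [sub_nonneg]
    simp only [hφ]
    exact sum_propensity_info_le _ (hc.trans_le (hv0 x).1) (hc.trans_le (hv1 x).1) _ _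
      (fun t _ => mul_nonneg (hκ t).1.le (hρ0 t x)) hx1 (fun t _ => he t x) hx2
  exact ⟨hpsd, fun hA => hA.posSemidef_inv_sub_inv hpsd⟩
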